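/- Combined smoothness estimate (intermediate step in the proof of Theorem 1): If 0 < η₁ ≤ 1/β, then for all θ, φ ∈ ℝ^d, ‖∇Ψ(θ) − ∇Ψ(φ)‖ ≤ ( η₁·L·ρ + (1 − η₁μ)²·β ) · ‖θ − φ‖, where L = L_f + mλ̄L_g, β = β_f + mλ̄β_g, μ = μ_f + mλ̄μ_g and ρ = ρ_f + mλ̄ρ_g. -/

import Mathlib

open scoped BigOperators

section GradientHessian

variable {E : Type*} [NormedAddCommGroup E] [InnerProductSpace ℝ E]

theorem norm_fderiv_le_of_norm_sub_le {F : E → E} {C : ℝ} (hC : 0 ≤ C)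
    (h : ∀ x y, ‖F x - F y‖ ≤ C * ‖x - y‖) (x : E) : ‖fderiv ℝ F x‖ ≤ C :=
  norm_fderiv_le_of_lip' ℝ hC (Filter.Eventually.of_forall fun y => h y x)

theorem ContinuousLinearMap.norm_le_of_inner_le (A : E →L[ℝ] E)
    (hA : A.IsSymmetric) {c : ℝ} (hc : 0 ≤ c) (h0 : ∀ v, 0 ≤ inner ℝ (A v) v)
    (h1 : ∀ v, inner ℝ (A v) v ≤ c * ‖v‖ ^ 2) : ‖A‖ ≤ c := by
  rw [A.norm_eq_iSup_rayleighQuotient hA]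
  refine Real.iSup_le (fun v => ?_) hc
  have h : A.rayleighQuotient v = inner ℝ (A v) v / ‖v‖ ^ 2 := rfl
  rw [h, abs_of_nonneg (div_nonneg (h0 v) (sq_nonneg _))]
  exact div_le_of_le_mul₀ (sq_nonneg _) hc (h1 v)

theorem norm_add_sum_smul_le {V ι : Type*} [SeminormedAddCommGroup V] [NormedSpace ℝ V] [Fintype ι]
    {a : V} {b : ι → V} {c : ι → ℝ} {A B : ℝ} (hc : ∀ i, 0 ≤ c i) (ha : ‖a‖ ≤ A)
    (hb : ∀ i, ‖b i‖ ≤ B) : ‖a + ∑ i, c i • b i‖ ≤ A + (∑ i, c i) * B := by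
  refine (norm_add_le _ _).trans (add_le_add ha ((norm_sum_le _ _).trans ?_))
  rw [Finset.sum_mul]
  refine Finset.sum_le_sum fun i _ => ?_
  rw [norm_smul, Real.norm_of_nonneg (hc i)]
  exact mul_le_mul_of_nonneg_left (hb i) (hc i)

variable [CompleteSpace E]

theorem ContDiff.gradient {f : E → ℝ} (hf : ContDiff ℝ 2 f) : ContDiff ℝ 1 (gradient f) :=
  (InnerProductSpace.toDual ℝ E).symm.toContinuousLinearEquiv.contDiff.comp
    (hf.fderiv_right (m := 1) (by norm_num))

theorem norm_gradient_le_of_lip {f : E → ℝ} {L : ℝ} (hL : 0 ≤ L)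
    (h : ∀ x y, |f x - f y| ≤ L * ‖x - y‖) (x : E) : ‖gradient f x‖ ≤ L := by
  rw [← (InnerProductSpace.toDual ℝ E).norm_map, toDual_gradient]
  exact norm_fderiv_le_of_lip' ℝ hL (Filter.Eventually.of_forall fun y => h y x)

/-- The Hessian, as the derivative of the gradient, is symmetric. -/
theorem isSymmetric_fderiv_gradient {f : E → ℝ} (hf : ContDiff ℝ 2 f) (x : E) :
    (fderiv ℝ (gradient f) x).IsSymmetric := by
  have key (v w : E) : inner ℝ (fderiv ℝ (gradient f) x v) w
      = fderiv ℝ (fderiv ℝ f) x v w := by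
    have h1 : (fun y => inner ℝ (gradient f y) w) = fun y => fderiv ℝ f y w :=
      funext fun y => inner_gradient_left
    have h2 : HasFDerivAt (fun y => fderiv ℝ f y w)
        ((fderiv ℝ (fderiv ℝ f) x).flip w) x := by
      have hd : DifferentiableAt ℝ (fderiv ℝ f) x :=
        (hf.fderiv_right (m := 1) (by norm_num)).differentiable one_ne_zero x
      simpa using hd.hasFDerivAt.clm_apply (hasFDerivAt_const w x)
    have h3 := (hf.gradient.differentiable one_ne_zero x).hasFDerivAt.inner ℝ
      (hasFDerivAt_const w x)
    rw [h1] at h3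
    simpa using congrArg (fun T : E →L[ℝ] ℝ => T v) (h3.unique h2)
  have hsymm : IsSymmSndFDerivAt ℝ f x := hf.contDiffAt.isSymmSndFDerivAt (by simp)
  intro v w
  change inner ℝ (fderiv ℝ (gradient f) x v) w
    = inner ℝ v (fderiv ℝ (gradient f) x w)
  rw [key, real_inner_comm, key, hsymm.eq]

theorem StrongConvexOn.le_inner_fderiv_gradient {f : E → ℝ} {μ : ℝ} (hf : ContDiff ℝ 2 f)
    (hsc : StrongConvexOn Set.univ μ f) (x v : E) :
    μ * ‖v‖ ^ 2 ≤ inner ℝ (fderiv ℝ (gradient f) x v) v := by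
  have hline (t : ℝ) : HasDerivAt (fun t : ℝ => x + t • v) v t := by
    simpa using ((hasDerivAt_id t).smul_const v).const_add x
  have hd1 (t : ℝ) : HasDerivAt (fun t : ℝ => f (x + t • v) - μ / 2 * ‖x + t • v‖ ^ 2)
      (inner ℝ (gradient f (x + t • v)) v - μ * inner ℝ (x + t • v) v) t := by
    have h1 := ((hf.differentiable two_ne_zero (x + t • v)).hasFDerivAt).comp_hasDerivAt t (hline t)
    rw [← inner_gradient_left] at h1
    refine (h1.sub ((hline t).norm_sq.const_mul (μ / 2))).congr_deriv ?_
    ring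
  have hd2 : HasDerivAt
      (fun t : ℝ => inner ℝ (gradient f (x + t • v)) v - μ * inner ℝ (x + t • v) v)
      (inner ℝ (fderiv ℝ (gradient f) x v) v - μ * inner ℝ v v) 0 := by
    have h0 : x + (0 : ℝ) • v = x := by simp
    have hg : HasFDerivAt (gradient f) (fderiv ℝ (gradient f) x) (x + (0 : ℝ) • v) := by
      rw [h0]
      exact (hf.gradient.differentiable one_ne_zero x).hasFDerivAt
    have h1 := (hg.comp_hasDerivAt (0 : ℝ) (hline 0)).inner ℝ (hasDerivAt_const (0 : ℝ) v)
    have h2 := ((hline 0).inner ℝ (hasDerivAt_const (0 : ℝ) v)).const_mul μ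
    refine (h1.sub h2).congr_deriv ?_
    simp
  have hconv : ConvexOn ℝ Set.univ (fun t : ℝ => f (x + t • v) - μ / 2 * ‖x + t • v‖ ^ 2) := by
    have h := (strongConvexOn_iff_convex.1 hsc).comp_affineMap (AffineMap.lineMap x (x + v))
    have heq : ((fun y => f y - μ / 2 * ‖y‖ ^ 2) ∘ AffineMap.lineMap x (x + v))
        = fun t : ℝ => f (x + t • v) - μ / 2 * ‖x + t • v‖ ^ 2 := by
      funext t
      simp [AffineMap.lineMap_apply, add_comm]
    rwa [heq, Set.preimage_univ] at h
  have hmono := hconv.monotoneOn_deriv fun t _ => (hd1 t).differentiableAt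
  rw [show deriv _ = _ from funext fun t => (hd1 t).deriv, monotoneOn_univ] at hmono
  have hnn := hmono.deriv_nonneg (x := 0)
  rw [hd2.deriv, real_inner_self_eq_norm_sq] at hnn
  linarith

/-- Smoothness of a function precomposed with one gradient step on it. -/
theorem norm_gradient_comp_gradient_step_sub_le [Nontrivial E] {Φ : E → ℝ} {L β μ ρ η : ℝ}
    (hΦ : ContDiff ℝ 2 Φ) (hL : ∀ x, ‖gradient Φ x‖ ≤ L) (hβ : ∀ x, ‖fderiv ℝ (gradient Φ) x‖ ≤ β)
    (hρ : ∀ x y, ‖fderiv ℝ (gradient Φ) x - fderiv ℝ (gradient Φ) y‖ ≤ ρ * ‖x - y‖)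
    (hμ : ∀ x v, μ * ‖v‖ ^ 2 ≤ inner ℝ (fderiv ℝ (gradient Φ) x v) v)
    (hη : 0 ≤ η) (hηβ : η * β ≤ 1) (x y : E) :
    ‖gradient (fun z => Φ (z - η • gradient Φ z)) x
        - gradient (fun z => Φ (z - η • gradient Φ z)) y‖
      ≤ (η * L * ρ + (1 - η * μ) ^ 2 * β) * ‖x - y‖ := by
  set G := gradient Φ with hG
  set A : E → E →L[ℝ] E := fun z => ContinuousLinearMap.id ℝ E - η • fderiv ℝ G z with hA
  set S : E → E := fun z => z - η • G z with hS
  have hSd (z : E) : HasFDerivAt S (A z) z :=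
    (hasFDerivAt_id z).sub ((hΦ.gradient.differentiable one_ne_zero z).hasFDerivAt.const_smul η)
  have hsymm (z : E) : (A z).IsSymmetric := by
    intro v w
    have := isSymmetric_fderiv_gradient hΦ z v w
    simp only [ContinuousLinearMap.coe_coe] at this
    simp [hA, inner_sub_left, inner_sub_right, inner_smul_left, inner_smul_right, this, hG]
  have hinner (z v : E) :
      inner ℝ (A z v) v = ‖v‖ ^ 2 - η * inner ℝ (fderiv ℝ G z v) v := by
    simp [hA, inner_sub_left, inner_smul_left]
  have hA0 (z v : E) : 0 ≤ inner ℝ (A z v) v := by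
    rw [hinner]
    have h1 : inner ℝ (fderiv ℝ G z v) v ≤ β * ‖v‖ ^ 2 := calc
      _ ≤ ‖fderiv ℝ G z v‖ * ‖v‖ := real_inner_le_norm _ _
      _ ≤ (β * ‖v‖) * ‖v‖ := by gcongr; exact (fderiv ℝ G z).le_of_opNorm_le (hβ z) v
      _ = _ := by ring
    nlinarith [mul_le_mul_of_nonneg_left h1 hη, mul_le_mul_of_nonneg_right hηβ (sq_nonneg ‖v‖)]
  have hA1 (z v : E) : inner ℝ (A z v) v ≤ (1 - η * μ) * ‖v‖ ^ 2 := by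
    rw [hinner]
    nlinarith [mul_le_mul_of_nonneg_left (hμ z v) hη]
  have hc : 0 ≤ 1 - η * μ := by
    obtain ⟨v, hv⟩ := exists_ne (0 : E)
    exact nonneg_of_mul_nonneg_left ((hA0 x v).trans (hA1 x v)) (by positivity)
  have hAn (z : E) : ‖A z‖ ≤ 1 - η * μ := (A z).norm_le_of_inner_le (hsymm z) hc (hA0 z) (hA1 z)
  have hgrad (z : E) : gradient (fun z => Φ (S z)) z = A z (G (S z)) := by
    refine ext_inner_right ℝ fun v => ?_
    have h1 := (hΦ.differentiable two_ne_zero (S z)).hasFDerivAt.comp z (hSd z)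
    have h2 : fderiv ℝ (fun z => Φ (S z)) z = (fderiv ℝ Φ (S z)).comp (A z) := h1.fderiv
    rw [inner_gradient_left, h2, ContinuousLinearMap.comp_apply, ← inner_gradient_left]
    exact (hsymm z (G (S z)) v).symm
  have hβ0 : 0 ≤ β := (norm_nonneg _).trans (hβ x)
  have hL0 : 0 ≤ L := (norm_nonneg _).trans (hL x)
  have hSlip : ‖S x - S y‖ ≤ (1 - η * μ) * ‖x - y‖ :=
    convex_univ.norm_image_sub_le_of_norm_hasFDerivWithin_le
      (fun z _ => (hSd z).hasFDerivWithinAt) (fun z _ => hAn z) (Set.mem_univ y) (Set.mem_univ x)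
  have hGlip : ‖G (S x) - G (S y)‖ ≤ β * ‖S x - S y‖ :=
    convex_univ.norm_image_sub_le_of_norm_fderiv_le
      (fun z _ => hΦ.gradient.differentiable one_ne_zero z) (fun z _ => hβ z)
      (Set.mem_univ _) (Set.mem_univ _)
  have hAlip : ‖A x - A y‖ ≤ η * (ρ * ‖x - y‖) := by
    have : A x - A y = η • (fderiv ℝ G y - fderiv ℝ G x) := by
      simp only [hA, smul_sub]; abel
    rw [this, norm_smul, Real.norm_of_nonneg hη, norm_sub_rev]
    exact mul_le_mul_of_nonneg_left (hρ x y) hη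
  rw [hgrad, hgrad]
  calc ‖A x (G (S x)) - A y (G (S y))‖
      = ‖(A x - A y) (G (S x)) + A y (G (S x) - G (S y))‖ := by
        congr 1; simp only [sub_apply, map_sub]; abel
    _ ≤ ‖A x - A y‖ * ‖G (S x)‖ + ‖A y‖ * ‖G (S x) - G (S y)‖ :=
        (norm_add_le _ _).trans (add_le_add ((A x - A y).le_opNorm _) ((A y).le_opNorm _))
    _ ≤ (η * (ρ * ‖x - y‖)) * L + (1 - η * μ) * (β * ((1 - η * μ) * ‖x - y‖)) := by
        refine add_le_add
          (mul_le_mul hAlip (hL _) (norm_nonneg _) ((norm_nonneg _).trans hAlip))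
          (mul_le_mul (hAn y) (hGlip.trans (mul_le_mul_of_nonneg_left hSlip hβ0))
            (norm_nonneg _) hc)
    _ = _ := by ring

theorem gradient_add_sum_mul {ι : Type*} [Fintype ι] {f : E → ℝ} {g : ι → E → ℝ} (c : ι → ℝ)
    (hf : Differentiable ℝ f) (hg : ∀ i, Differentiable ℝ (g i)) :
    gradient (fun x => f x + ∑ i, c i * g i x)
      = fun x => gradient f x + ∑ i, c i • gradient (g i) x := by
  funext x
  refine HasGradientAt.gradient ?_
  rw [hasGradientAt_iff_hasFDerivAt, map_add, map_sum]
  simp only [map_smul, toDual_gradient]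
  exact (hf x).hasFDerivAt.add
    (HasFDerivAt.fun_sum fun i _ => (hg i x).hasFDerivAt.const_mul (c i))

end GradientHessian

/-- **Combined smoothness estimate (intermediate step in the proof of Theorem 1).**
If `0 < η₁ ≤ 1/β`, then `‖∇Ψ(θ) − ∇Ψ(φ)‖ ≤ (η₁Lρ + (1 − η₁μ)²β) ‖θ − φ‖`. -/
theorem ffml_theorem1_combined_upper
    {d m : ℕ} (hm : 1 ≤ m)
    (f : EuclideanSpace ℝ (Fin d) → ℝ) (g : Fin m → EuclideanSpace ℝ (Fin d) → ℝ)
    (Lf βf ρf μf Lg βg ρg μg : ℝ)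
    (hf_cd : ContDiff ℝ 2 f) (hg_cd : ∀ i, ContDiff ℝ 2 (g i))
    (hf_lip : ∀ θ φ, |f θ - f φ| ≤ Lf * ‖θ - φ‖)
    (hf_grad_lip : ∀ θ φ, ‖gradient f θ - gradient f φ‖ ≤ βf * ‖θ - φ‖)
    (hf_hess_lip : ∀ θ φ,
      ‖fderiv ℝ (gradient f) θ - fderiv ℝ (gradient f) φ‖ ≤ ρf * ‖θ - φ‖)
    (hf_sc : StrongConvexOn Set.univ μf f)
    (hg_lip : ∀ i θ φ, |g i θ - g i φ| ≤ Lg * ‖θ - φ‖)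
    (hg_grad_lip : ∀ i θ φ, ‖gradient (g i) θ - gradient (g i) φ‖ ≤ βg * ‖θ - φ‖)
    (hg_hess_lip : ∀ i θ φ,
      ‖fderiv ℝ (gradient (g i)) θ - fderiv ℝ (gradient (g i)) φ‖ ≤ ρg * ‖θ - φ‖)
    (hg_sc : ∀ i, StrongConvexOn Set.univ μg (g i))
    (lam : Fin m → ℝ) (hlam : ∀ i, 0 ≤ lam i)
    (lamBar : ℝ) (hlamBar : lamBar = (1 / (m : ℝ)) * ∑ i, lam i)
    (L β μ ρ : ℝ)
    (hL : L = Lf + m * lamBar * Lg) (hβ : β = βf + m * lamBar * βg)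
    (hμ : μ = μf + m * lamBar * μg) (hρ : ρ = ρf + m * lamBar * ρg)
    (η₁ : ℝ) (hη₁ : 0 < η₁)
    (hstep : η₁ ≤ 1 / β)
    (Φ : EuclideanSpace ℝ (Fin d) → ℝ) (hΦ : Φ = fun θ => f θ + ∑ i, lam i * g i θ)
    (Alg : EuclideanSpace ℝ (Fin d) → EuclideanSpace ℝ (Fin d))
    (hAlg : Alg = fun θ => θ - η₁ • gradient Φ θ)
    (Ψ : EuclideanSpace ℝ (Fin d) → ℝ) (hΨ : Ψ = fun θ => Φ (Alg θ)) :
    ∀ θ φ : EuclideanSpace ℝ (Fin d),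
      ‖gradient Ψ θ - gradient Ψ φ‖
        ≤ (η₁ * L * ρ + (1 - η₁ * μ) ^ 2 * β) * ‖θ - φ‖ := by
  intro θ φ
  rcases eq_or_ne θ φ with rfl | hne
  · simp
  have : Nontrivial (EuclideanSpace ℝ (Fin d)) := ⟨θ, φ, hne⟩
  have hpos : 0 < ‖θ - φ‖ := norm_pos_iff.2 (sub_ne_zero.2 hne)
  have hsum : (m : ℝ) * lamBar = ∑ i, lam i := by
    have : (m : ℝ) ≠ 0 := by positivity
    rw [hlamBar]
    field_simp
  rw [hsum] at hL hβ hμ hρ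
  have hLf : 0 ≤ Lf := nonneg_of_mul_nonneg_left ((abs_nonneg _).trans (hf_lip θ φ)) hpos
  have hLg : 0 ≤ Lg :=
    nonneg_of_mul_nonneg_left ((abs_nonneg _).trans (hg_lip ⟨0, hm⟩ θ φ)) hpos
  have hβf : 0 ≤ βf := nonneg_of_mul_nonneg_left ((norm_nonneg _).trans (hf_grad_lip θ φ)) hpos
  have hβg : 0 ≤ βg :=
    nonneg_of_mul_nonneg_left ((norm_nonneg _).trans (hg_grad_lip ⟨0, hm⟩ θ φ)) hpos
  have hβpos : 0 < β := one_div_pos.1 (hη₁.trans_le hstep)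
  have hΦcd : ContDiff ℝ 2 Φ := by
    rw [hΦ]
    exact hf_cd.add (ContDiff.sum fun i _ => contDiff_const.mul (hg_cd i))
  have hgrad : gradient Φ = fun x => gradient f x + ∑ i, lam i • gradient (g i) x := by
    rw [hΦ]
    exact gradient_add_sum_mul lam (hf_cd.differentiable two_ne_zero)
      fun i => (hg_cd i).differentiable two_ne_zero
  have hhess (x) : fderiv ℝ (gradient Φ) x
      = fderiv ℝ (gradient f) x + ∑ i, lam i • fderiv ℝ (gradient (g i)) x := by
    rw [hgrad]
    exact ((hf_cd.gradient.differentiable one_ne_zero x).hasFDerivAt.add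
      (HasFDerivAt.fun_sum fun i _ =>
        ((hg_cd i).gradient.differentiable one_ne_zero x).hasFDerivAt.const_smul (lam i))).fderiv
  subst hΨ hAlg
  refine norm_gradient_comp_gradient_step_sub_le hΦcd (fun x => ?_) (fun x => ?_)
    (fun x y => ?_) (fun x v => ?_) hη₁.le ((le_div_iff₀ hβpos).1 hstep) θ φ
  · rw [hgrad, hL]
    exact norm_add_sum_smul_le hlam (norm_gradient_le_of_lip hLf hf_lip x)
      fun i => norm_gradient_le_of_lip hLg (hg_lip i) x
  · rw [hhess, hβ]
    exact norm_add_sum_smul_le hlam (norm_fderiv_le_of_norm_sub_le hβf hf_grad_lip x)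
      fun i => norm_fderiv_le_of_norm_sub_le hβg (hg_grad_lip i) x
  · rw [hhess, hhess, hρ, add_sub_add_comm, ← Finset.sum_sub_distrib, add_mul, mul_assoc]
    simp only [← smul_sub]
    exact norm_add_sum_smul_le hlam (hf_hess_lip x y) fun i => hg_hess_lip i x y
  · rw [hhess, hμ, add_mul, add_apply, inner_add_left,
      sum_apply, sum_inner, mul_assoc, Finset.sum_mul]
    refine add_le_add (hf_sc.le_inner_fderiv_gradient hf_cd x v)
      (Finset.sum_le_sum fun i _ => ?_)
    rw [smul_apply, real_inner_smul_left]
    exact mul_le_mul_of_nonneg_left ((hg_sc i).le_inner_fderiv_gradient (hg_cd i) x v) (hlam i)
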